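/- Let W be an invertible contraction on a Hilbert space H such that sup_{n≥0} ‖W⁻ⁿ‖ < ∞. Then the strong limit V := s-lim_{n→∞} W*ⁿWⁿ exists, is a nonnegative self-adjoint operator, and is uniformly positive: V ≥ δI for some δ > 0. -/

import Mathlib

open scoped InnerProductSpace
open Filter

namespace ContinuousLinearMap

variable {H : Type*} [NormedAddCommGroup H] [InnerProductSpace ℂ H]

theorem norm_pow_le_one_of_norm_le_one {W : H →L[ℂ] H} (hW : ‖W‖ ≤ 1) (n : ℕ) :
    ‖W ^ n‖ ≤ 1 := by
  induction n with
  | zero => exact norm_id_le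
  | succ k ih =>
    rw [pow_succ]
    exact (norm_mul_le _ _).trans (mul_le_one₀ ih (norm_nonneg _) hW)

theorem antitone_norm_pow_apply {W : H →L[ℂ] H} (hW : ‖W‖ ≤ 1) (x : H) :
    Antitone fun n : ℕ => ‖(W ^ n) x‖ :=
  antitone_nat_of_succ_le fun n => by
    rw [pow_succ', mul_apply_eq_comp]
    exact (W.le_of_opNorm_le hW _).trans_eq (one_mul _)

variable [CompleteSpace H]

theorem inner_adjoint_pow_pow_left (W : H →L[ℂ] H) (n : ℕ) (x y : H) :
    ⟪(adjoint W ^ n) ((W ^ n) x), y⟫_ℂ = ⟪(W ^ n) x, (W ^ n) y⟫_ℂ := by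
  rw [← star_eq_adjoint, ← star_pow, star_eq_adjoint, adjoint_inner_left]

theorem re_inner_adjoint_pow_pow_self (W : H →L[ℂ] H) (n : ℕ) (x : H) :
    (⟪(adjoint W ^ n) ((W ^ n) x), x⟫_ℂ).re = ‖(W ^ n) x‖ ^ 2 := by
  rw [inner_adjoint_pow_pow_left]
  exact inner_self_eq_norm_sq (𝕜 := ℂ) _

/-- For a contraction `A`, the defect operator `1 - A*A` satisfies
`‖(1 - A*A) y‖² ≤ ⟪(1 - A*A) y, y⟫`. -/
theorem norm_sub_adjoint_apply_sq_le {A : H →L[ℂ] H} (hA : ‖A‖ ≤ 1) (y : H) :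
    ‖y - adjoint A (A y)‖ ^ 2 ≤ ‖y‖ ^ 2 - ‖A y‖ ^ 2 := by
  have hA' : ‖adjoint A‖ ≤ 1 := (LinearIsometryEquiv.norm_map adjoint A).trans_le hA
  have hle : ‖adjoint A (A y)‖ ≤ ‖A y‖ :=
    ((adjoint A).le_of_opNorm_le hA' _).trans_eq (one_mul _)
  have hre : RCLike.re ⟪y, adjoint A (A y)⟫_ℂ = ‖A y‖ ^ 2 := by
    rw [adjoint_inner_right]
    exact inner_self_eq_norm_sq (𝕜 := ℂ) _
  rw [norm_sub_sq (𝕜 := ℂ), hre]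
  have := pow_le_pow_left₀ (norm_nonneg _) hle 2
  linarith

theorem norm_adjoint_pow_pow_sub_sq_le {W : H →L[ℂ] H} (hW : ‖W‖ ≤ 1) {m n : ℕ}
    (hmn : m ≤ n) (x : H) :
    ‖(adjoint W ^ m) ((W ^ m) x) - (adjoint W ^ n) ((W ^ n) x)‖ ^ 2 ≤
      ‖(W ^ m) x‖ ^ 2 - ‖(W ^ n) x‖ ^ 2 := by
  obtain ⟨k, rfl⟩ := Nat.exists_eq_add_of_le hmn
  have hW' : ‖adjoint W‖ ≤ 1 := (LinearIsometryEquiv.norm_map adjoint W).trans_le hW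
  have hadj : adjoint W ^ k = adjoint (W ^ k) := by
    rw [← star_eq_adjoint, ← star_pow, star_eq_adjoint]
  have hpow : (W ^ (m + k)) x = (W ^ k) ((W ^ m) x) := by
    rw [add_comm, pow_add, mul_apply_eq_comp]
  rw [hpow, pow_add (adjoint W), mul_apply_eq_comp, ← map_sub, hadj]
  refine le_trans (pow_le_pow_left₀ (norm_nonneg _) ?_ 2)
    (norm_sub_adjoint_apply_sq_le (norm_pow_le_one_of_norm_le_one hW k) ((W ^ m) x))
  exact (le_of_opNorm_le _ (norm_pow_le_one_of_norm_le_one hW' m) _).trans_eq (one_mul _)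

theorem cauchySeq_adjoint_pow_pow_apply {W : H →L[ℂ] H} (hW : ‖W‖ ≤ 1) (x : H) :
    CauchySeq fun n : ℕ => (adjoint W ^ n) ((W ^ n) x) := by
  have hanti : Antitone fun n : ℕ => ‖(W ^ n) x‖ ^ 2 := fun m n hmn =>
    pow_le_pow_left₀ (norm_nonneg _) (antitone_norm_pow_apply hW x hmn) 2
  have hbdd : BddBelow (Set.range fun n : ℕ => ‖(W ^ n) x‖ ^ 2) :=
    ⟨0, by rintro _ ⟨n, rfl⟩; positivity⟩
  have hcauchy := (tendsto_atTop_ciInf hanti hbdd).cauchySeq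
  rw [Metric.cauchySeq_iff'] at hcauchy ⊢
  intro ε hε
  obtain ⟨N, hN⟩ := hcauchy (ε ^ 2) (by positivity)
  refine ⟨N, fun n hn => ?_⟩
  have hlt := hN n hn
  rw [dist_comm, Real.dist_eq] at hlt
  rw [dist_comm, dist_eq_norm]
  exact lt_of_pow_lt_pow_left₀ 2 hε.le <|
    (norm_adjoint_pow_pow_sub_sq_le hW hn x).trans_lt ((le_abs_self _).trans_lt hlt)

end ContinuousLinearMap

/-- If `W` is an invertible contraction with `sup_n ‖W⁻ⁿ‖ < ∞`, then the
strong limit `V = s-lim W*ⁿ Wⁿ` exists, is a nonnegative self-adjoint operator, and is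
uniformly positive: `V ≥ δ I` for some `δ > 0`. -/
theorem strong_limit_uniformly_positive
    {H : Type*} [NormedAddCommGroup H] [InnerProductSpace ℂ H] [CompleteSpace H]
    (W W' : H →L[ℂ] H) (hW : ‖W‖ ≤ 1)
    (hinv₁ : W * W' = 1) (hinv₂ : W' * W = 1)
    (C : ℝ) (hC : ∀ n : ℕ, ‖W' ^ n‖ ≤ C) :
    ∃ V : H →L[ℂ] H,
      (∀ x, Tendsto (fun n : ℕ => ((ContinuousLinearMap.adjoint W) ^ n) ((W ^ n) x))
        atTop (nhds (V x))) ∧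
      IsSelfAdjoint V ∧
      (∀ x, 0 ≤ (⟪V x, x⟫_ℂ).re) ∧
      ∃ δ : ℝ, 0 < δ ∧ ∀ x, δ * ‖x‖ ^ 2 ≤ (⟪V x, x⟫_ℂ).re := by
  choose f hf using fun x =>
    cauchySeq_tendsto_of_complete (ContinuousLinearMap.cauchySeq_adjoint_pow_pow_apply hW x)
  let V : H →L[ℂ] H := continuousLinearMapOfTendsto
    (fun n : ℕ => ContinuousLinearMap.adjoint W ^ n * W ^ n) (tendsto_pi_nhds.2 hf)
  have hV (x : H) : Tendsto
      (fun n : ℕ => (ContinuousLinearMap.adjoint W ^ n) ((W ^ n) x)) atTop (nhds (V x)) := hf x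
  have hre (x : H) : Tendsto (fun n : ℕ => ‖(W ^ n) x‖ ^ 2) atTop
      (nhds (⟪V x, x⟫_ℂ).re) := by
    simpa only [Function.comp_def, ContinuousLinearMap.re_inner_adjoint_pow_pow_self] using
      (Complex.continuous_re.tendsto _).comp ((hV x).inner (tendsto_const_nhds (x := x)))
  refine ⟨V, hV, ?_, fun x => ge_of_tendsto' (hre x) fun n => by positivity,
    (max C 1 ^ 2)⁻¹, by positivity, fun x => ge_of_tendsto' (hre x) fun n => ?_⟩
  · rw [ContinuousLinearMap.isSelfAdjoint_iff_isSymmetric]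
    intro x y
    have hleft := (hV x).inner (𝕜 := ℂ) (tendsto_const_nhds (x := y))
    have hright := (tendsto_const_nhds (x := x)).inner (𝕜 := ℂ) (hV y)
    refine tendsto_nhds_unique hleft (hright.congr fun n => ?_)
    rw [ContinuousLinearMap.inner_adjoint_pow_pow_left, ← inner_conj_symm,
      ContinuousLinearMap.inner_adjoint_pow_pow_left, inner_conj_symm]
  · have hleft_inv : (W' ^ n) ((W ^ n) x) = x := by
      rw [← mul_apply_eq_comp,
        ← (show Commute W' W from hinv₂.trans hinv₁.symm).mul_pow, hinv₂, one_pow,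
        one_apply_eq_self]
    have hle : ‖x‖ ≤ max C 1 * ‖(W ^ n) x‖ := by
      simpa only [hleft_inv] using
        (W' ^ n).le_of_opNorm_le ((hC n).trans (le_max_left C 1)) ((W ^ n) x)
    rw [inv_mul_le_iff₀ (by positivity), ← mul_pow]
    exact pow_le_pow_left₀ (norm_nonneg _) hle 2
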